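/- The d-dimensional binomial random hyper-graph model admits concentration constant 1/4, and the random d-word model admits concentration constant 1/(4d). That is: if H is chosen according to G(K_{n_1,…,n_d},p) and Med is any median of L(H), then for all s ≥ 0, P(L(H) ≤ (1−s)Med) ≤ 2 exp(−s² Med /4) and P(L(H) ≥ (1+s)Med) ≤ 2 exp(−(s²/(1+s)) Med /4); and if H is chosen according to Σ(K_{n_1,…,n_d},k) and Med is any median of L(H), then for all s ≥ 0, P(L(H) ≤ (1−s)Med) ≤ 2 exp(−s² Med /(4d)) and P(L(H) ≥ (1+s)Med) ≤ 2 exp(−(s²/(1+s)) Med /(4d)). -/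

import Mathlib

open Finset MeasureTheory
open scoped Classical BigOperators

/-- An edge of the complete `d`-partite hyper-graph with color classes `[n 0], …, [n (d-1)]`. -/
abbrev Edge {d : ℕ} (n : Fin d → ℕ) := ∀ i : Fin d, Fin (n i)

/-- A `d`-partite hyper-graph, identified with its edge set. -/
abbrev HG {d : ℕ} (n : Fin d → ℕ) := Finset (Edge n)

/-- A finite set of edges is a non-crossing hyper-matching iff any two distinct edges of it
are strictly comparable in every coordinate (equivalently: pairwise node-disjoint and
totally ordered by the componentwise partial order). -/
def NonCrossing {d : ℕ} {n : Fin d → ℕ} (M : Finset (Edge n)) : Prop :=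
  ∀ e ∈ M, ∀ f ∈ M, e ≠ f → (∀ i, e i < f i) ∨ (∀ i, f i < e i)

/-- `L G` is the maximum size of a non-crossing hyper-matching contained in `G`. -/
noncomputable def L {d : ℕ} {n : Fin d → ℕ} (G : HG n) : ℕ :=
  (G.powerset.filter NonCrossing).sup Finset.card

/-- Expectation of `f` under the weight function `w` on a finite outcome type. -/
noncomputable def wExp {α : Type*} [Fintype α] (w : α → ℝ) (f : α → ℝ) : ℝ :=
  ∑ a, w a * f a

/-- Probability of the event `A` under the weight function `w`. -/
noncomputable def wProb {α : Type*} [Fintype α] (w : α → ℝ) (A : Set α) : ℝ :=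
  ∑ a ∈ Finset.univ.filter (· ∈ A), w a

/-- `m` is a median of the random variable `X` under the weights `w`. -/
def IsMedianW {α : Type*} [Fintype α] (w : α → ℝ) (X : α → ℝ) (m : ℝ) : Prop :=
  1 / 2 ≤ wProb w {a | X a ≤ m} ∧ 1 / 2 ≤ wProb w {a | m ≤ X a}

/-- The probability of the outcome `H` in the binomial model in which every element of `α`
is present independently with probability `p`. -/
noncomputable def binomW {α : Type*} [Fintype α] (p : ℝ) (H : Finset α) : ℝ :=
  ∏ a : α, if a ∈ H then p else 1 - p

/-- Weights of the uniform distribution on a finite type. -/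
noncomputable def unifW (α : Type*) [Fintype α] : α → ℝ := fun _ => (Fintype.card α : ℝ)⁻¹

/-- Geometric mean of the class sizes. -/
noncomputable def geoMean {d : ℕ} (n : Fin d → ℕ) : ℝ :=
  (∏ i, (n i : ℝ)) ^ (1 / (d : ℝ))

/-- Sum of the class sizes. -/
def sumSizes {d : ℕ} (n : Fin d → ℕ) : ℝ := ∑ i, (n i : ℝ)

/-- The outcome space of the random `d`-word model: an assignment of one of `k` letters
to every vertex. -/
abbrev WordOmega {d : ℕ} (n : Fin d → ℕ) (k : ℕ) := (Σ i : Fin d, Fin (n i)) → Fin k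

/-- The hyper-graph associated with a letter assignment: an edge is present iff all of its
vertices receive the same letter. -/
noncomputable def wordGraph {d : ℕ} {n : Fin d → ℕ} {k : ℕ} (ω : WordOmega n k) : HG n :=
  Finset.univ.filter (fun e : Edge n => ∀ i j : Fin d, ω ⟨i, e i⟩ = ω ⟨j, e j⟩)

/-- The set of edges of `H` sharing no vertex with any other edge of `H`. -/
noncomputable def isolated {d : ℕ} {n : Fin d → ℕ} (H : HG n) : HG n :=
  H.filter (fun e => ∀ f ∈ H, f ≠ e → ∀ i, e i ≠ f i)

/-- Length of a longest chain among the points `x 0, …, x (m-1)` of `ℝ^d` under the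
componentwise strict order. -/
noncomputable def cubeChain (d m : ℕ) (x : Fin m → Fin d → ℝ) : ℕ :=
  ((Finset.univ : Finset (Finset (Fin m))).filter
    (fun S => ∀ a ∈ S, ∀ b ∈ S, a ≠ b →
      (∀ i, x a i < x b i) ∨ (∀ i, x b i < x a i))).sup Finset.card

/-- The unit cube `[0,1]^d`, to the `m`-th power. -/
def unitCube (d m : ℕ) : Set (Fin m → Fin d → ℝ) := {x | ∀ a i, x a i ∈ Set.Icc (0 : ℝ) 1}

/-- `c` is the Bollobás–Winkler constant in dimension `d`:
`E[H_d(m)] / m^(1/d) → c` as `m → ∞`, where `H_d(m)` is the length of a longest chain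
among `m` independent uniform random points in the unit cube `[0,1]^d`. -/
def IsBWConstant (d : ℕ) (c : ℝ) : Prop :=
  Filter.Tendsto
    (fun m : ℕ => (∫ x in unitCube d m, (cubeChain d m x : ℝ)) / (m : ℝ) ^ (1 / (d : ℝ)))
    Filter.atTop (nhds c)


/-- The weight of a point of a power space in the product of the weights `w`. -/
noncomputable def prodW {ι α : Type*} [Fintype ι] (w : α → ℝ) (x : ι → α) : ℝ := ∏ i, w (x i)

/-- `v` dominates, in every nonnegative direction, a convex combination of the
`0`-`1`-vectors marking the coordinates in which `x` differs from a point of `A`. -/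
def Dominates {ι α : Type*} [Fintype ι] (A : Set (ι → α)) (x : ι → α) (v : ι → ℝ) : Prop :=
  ∀ (c : ι → ℝ) (t : ℝ), (∀ i, 0 ≤ c i) →
    (∀ y ∈ A, t ≤ ∑ i, c i * if x i = y i then 0 else 1) → t ≤ ∑ i, c i * v i

section Weights

variable {α β : Type*} [Fintype α] [Fintype β]

lemma wProb_eq_sum_ite (w : α → ℝ) (A : Set α) :
    wProb w A = ∑ a, if a ∈ A then w a else 0 := by
  rw [wProb, Finset.sum_filter]

lemma wProb_nonneg {w : α → ℝ} (hw : ∀ a, 0 ≤ w a) (A : Set α) : 0 ≤ wProb w A :=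
  Finset.sum_nonneg fun a _ => hw a

lemma wProb_mono {w : α → ℝ} (hw : ∀ a, 0 ≤ w a) {A B : Set α} (h : A ⊆ B) :
    wProb w A ≤ wProb w B := by
  refine Finset.sum_le_sum_of_subset_of_nonneg (fun a ha => ?_) fun a _ _ => hw a
  simp only [Finset.mem_filter, Finset.mem_univ, true_and] at ha ⊢
  exact h ha

lemma wProb_le_one {w : α → ℝ} (hw : ∀ a, 0 ≤ w a) (hs : ∑ a, w a ≤ 1) (A : Set α) :
    wProb w A ≤ 1 :=
  (Finset.sum_le_sum_of_subset_of_nonneg (Finset.filter_subset _ _) fun a _ _ => hw a).trans hs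

lemma wProb_empty (w : α → ℝ) : wProb w (∅ : Set α) = 0 := by
  simp [wProb]

lemma wProb_equiv (φ : α ≃ β) (w : α → ℝ) (w' : β → ℝ) (h : ∀ a, w a = w' (φ a))
    (A : Set α) : wProb w A = wProb w' {b | φ.symm b ∈ A} := by
  rw [wProb_eq_sum_ite, wProb_eq_sum_ite]
  refine Fintype.sum_equiv φ _ _ fun a => ?_
  simp [h]

lemma prodW_nonneg {α : Type*} {w : α → ℝ} (hw : ∀ a, 0 ≤ w a) (x : β → α) : 0 ≤ prodW w x :=
  Finset.prod_nonneg fun i _ => hw (x i)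

lemma sum_prodW_le_one [DecidableEq β] {w : α → ℝ} (hw : ∀ a, 0 ≤ w a) (hs : ∑ a, w a ≤ 1) :
    ∑ x : β → α, prodW w x ≤ 1 := by
  have h : ∑ x : β → α, prodW w x = ∏ _i : β, ∑ a, w a := by
    simp only [prodW]
    rw [Finset.prod_univ_sum, Fintype.piFinset_univ]
  rw [h]
  exact Finset.prod_le_one (fun _ _ => Finset.sum_nonneg fun a _ => hw a) fun _ _ => hs

lemma sum_fin_succ_arrow {m : ℕ} (f : (Fin (m + 1) → α) → ℝ) :
    ∑ z, f z = ∑ a, ∑ x : Fin m → α, f (Fin.cons a x) := by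
  rw [← Fintype.sum_prod_type']
  exact (Fintype.sum_equiv (Fin.consEquiv fun _ => α) _ _ fun z => rfl).symm

lemma prodW_cons {α : Type*} {m : ℕ} (w : α → ℝ) (a : α) (x : Fin m → α) :
    prodW w (Fin.cons a x : Fin (m + 1) → α) = w a * prodW w x := by
  simp [prodW, Fin.prod_univ_succ]

lemma wProb_prodW_succ {m : ℕ} (w : α → ℝ) (A : Set (Fin (m + 1) → α)) :
    wProb (prodW w) A =
      ∑ a, w a * wProb (prodW w) {x : Fin m → α | (Fin.cons a x : Fin (m + 1) → α) ∈ A} := by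
  rw [wProb_eq_sum_ite, sum_fin_succ_arrow]
  refine Finset.sum_congr rfl fun a _ => ?_
  rw [wProb_eq_sum_ite, Finset.mul_sum]
  refine Finset.sum_congr rfl fun x _ => ?_
  rw [prodW_cons]
  simp only [Set.mem_ofPred_eq, mul_ite, mul_zero]

end Weights

section Analytic

lemma exp_neg_le_quadratic {u : ℝ} (hu : 0 ≤ u) : Real.exp (-u) ≤ 1 - u + u ^ 2 / 2 := by
  rw [Real.exp_neg]
  have h := Real.quadratic_le_exp_of_nonneg hu
  have h0 : 0 < 1 - u + u ^ 2 / 2 := by nlinarith [sq_nonneg (u - 1)]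
  rw [inv_le_comm₀ (Real.exp_pos u) h0]
  refine le_trans ?_ h
  rw [inv_le_iff_one_le_mul₀ h0]
  nlinarith [sq_nonneg (u ^ 2)]

lemma exp_le_cubic {v : ℝ} (h0 : 0 ≤ v) (h1 : v ≤ 1) :
    Real.exp v ≤ 1 + v + v ^ 2 / 2 + v ^ 3 := by
  have h := Real.exp_bound' h0 h1 (n := 3) (by norm_num)
  norm_num [Finset.sum_range_succ, Nat.factorial] at h
  nlinarith [pow_nonneg h0 3]

lemma exp_sub_sq_add_exp_neg_le {u : ℝ} (h0 : 0 ≤ u) (h1 : u ≤ 1 / 2) :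
    Real.exp (u - u ^ 2) + Real.exp (-u) ≤ 2 := by
  have hv0 : 0 ≤ u - u ^ 2 := by nlinarith
  have hv1 : u - u ^ 2 ≤ 1 := by nlinarith
  have ha := exp_le_cubic hv0 hv1
  have hb := exp_neg_le_quadratic h0
  have hc : (1 - u) ^ 3 ≤ 1 - u := by
    have : (1 - u) ^ 2 ≤ 1 := by nlinarith
    nlinarith
  have hd : u ^ 3 * (1 - u) ^ 3 ≤ u ^ 3 * (1 - u) :=
    mul_le_mul_of_nonneg_left hc (pow_nonneg h0 3)
  nlinarith [pow_nonneg h0 3, pow_nonneg h0 4]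

/-- The numerical inequality behind the induction step of Talagrand's inequality. -/
lemma exists_interpolation {r : ℝ} (h0 : 0 < r) (h1 : r ≤ 1) :
    ∃ l : ℝ, 0 ≤ l ∧ l ≤ 1 ∧
      Real.exp (-(l * Real.log r) + (1 - l) ^ 2 / 4) ≤ 2 - r := by
  have hlog : Real.log r ≤ 0 := Real.log_nonpos h0.le h1
  by_cases h : -(1 / 2) ≤ Real.log r
  · refine ⟨1 + 2 * Real.log r, by linarith, by linarith, ?_⟩
    have key := exp_sub_sq_add_exp_neg_le (u := -Real.log r) (by linarith) (by linarith)
    rw [neg_neg, Real.exp_log h0] at key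
    calc _ = Real.exp (-Real.log r - (-Real.log r) ^ 2) := by ring_nf
      _ ≤ 2 - r := by linarith
  · refine ⟨0, le_rfl, zero_le_one, ?_⟩
    have hr : r ≤ Real.exp (-(1 / 2)) := by
      rw [← Real.exp_log h0]
      exact Real.exp_le_exp.mpr (not_le.mp h).le
    have key := exp_sub_sq_add_exp_neg_le (u := 1 / 2) (by norm_num) le_rfl
    norm_num at key hr ⊢
    linarith

end Analytic

section Talagrand

variable {α : Type*} [Fintype α]

lemma Dominates.convex_comb {ι α : Type*} [Fintype ι] {A : Set (ι → α)} {x : ι → α}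
    {u v : ι → ℝ}
    (hu : Dominates A x u) (hv : Dominates A x v) {l : ℝ} (h0 : 0 ≤ l) (h1 : l ≤ 1) :
    Dominates A x fun i => l * u i + (1 - l) * v i := by
  intro c t hc h
  have hu' := hu c t hc h
  have hv' := hv c t hc h
  have : ∑ i, c i * (l * u i + (1 - l) * v i) =
      l * ∑ i, c i * u i + (1 - l) * ∑ i, c i * v i := by
    rw [Finset.mul_sum, Finset.mul_sum, ← Finset.sum_add_distrib]
    exact Finset.sum_congr rfl fun i _ => by ring
  rw [this]
  nlinarith

lemma Dominates.cons_section {α : Type*} {m : ℕ} {A : Set (Fin (m + 1) → α)} {a : α} {x : Fin m → α}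
    {u : Fin m → ℝ}
    (hu : Dominates {y : Fin m → α | (Fin.cons a y : Fin (m + 1) → α) ∈ A} x u) :
    Dominates A (Fin.cons a x) (Fin.cons 0 u) := by
  intro c t hc h
  have := hu (fun i => c i.succ) t (fun i => hc _) fun y hy => by
    simpa [Fin.sum_univ_succ] using h _ hy
  simpa [Fin.sum_univ_succ] using this

lemma Dominates.cons_projection {α : Type*} {m : ℕ} {A : Set (Fin (m + 1) → α)} (a : α)
    {x : Fin m → α} {u : Fin m → ℝ}
    (hu : Dominates {y : Fin m → α | ∃ b, (Fin.cons b y : Fin (m + 1) → α) ∈ A} x u) :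
    Dominates A (Fin.cons a x) (Fin.cons 1 u) := by
  intro c t hc h
  have := hu (fun i => c i.succ) (t - c 0) (fun i => hc _) fun y ⟨b, hb⟩ => by
    have h2 := h _ hb
    simp only [Fin.sum_univ_succ, Fin.cons_zero, Fin.cons_succ] at h2
    have h3 : c 0 * (if a = b then 0 else 1) ≤ c 0 := by
      split_ifs <;> simp [hc 0]
    linarith
  simp only [Fin.sum_univ_succ, Fin.cons_zero, Fin.cons_succ]
  linarith

/-- Hölder's inequality for exponentials, in normalized form. -/
lemma sum_exp_interpolate_le {β : Type*} [Fintype β] {w f g : β → ℝ} (hw : ∀ x, 0 ≤ w x)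
    {A B l : ℝ} (hA : 0 < A) (hB : 0 < B) (h0 : 0 ≤ l) (h1 : l ≤ 1)
    (hf : (∑ x, w x * Real.exp (f x)) * A ≤ 1) (hg : (∑ x, w x * Real.exp (g x)) * B ≤ 1) :
    (∑ x, w x * Real.exp (l * f x + (1 - l) * g x)) * B ≤ Real.exp (-(l * Real.log (A / B))) := by
  have hpt : ∀ x, Real.exp (l * f x + (1 - l) * g x) * B ≤
      Real.exp (-(l * Real.log (A / B))) *
        (l * (Real.exp (f x) * A) + (1 - l) * (Real.exp (g x) * B)) := by
    intro x
    have hc := convexOn_exp.2 (Set.mem_univ (f x + Real.log A)) (Set.mem_univ (g x + Real.log B))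
      h0 (sub_nonneg.mpr h1) (by ring)
    simp only [smul_eq_mul, Real.exp_add (f x), Real.exp_add (g x), Real.exp_log hA,
      Real.exp_log hB] at hc
    calc Real.exp (l * f x + (1 - l) * g x) * B
        = Real.exp (-(l * Real.log (A / B))) *
          Real.exp (l * (f x + Real.log A) + (1 - l) * (g x + Real.log B)) := by
          rw [← Real.exp_add, Real.log_div hA.ne' hB.ne']
          conv_lhs => rw [← Real.exp_log hB, ← Real.exp_add]
          ring_nf
      _ ≤ _ := mul_le_mul_of_nonneg_left hc (Real.exp_pos _).le
  calc (∑ x, w x * Real.exp (l * f x + (1 - l) * g x)) * B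
      = ∑ x, w x * (Real.exp (l * f x + (1 - l) * g x) * B) := by
        rw [Finset.sum_mul]; exact Finset.sum_congr rfl fun x _ => by ring
    _ ≤ ∑ x, w x * (Real.exp (-(l * Real.log (A / B))) *
        (l * (Real.exp (f x) * A) + (1 - l) * (Real.exp (g x) * B))) :=
        Finset.sum_le_sum fun x _ => mul_le_mul_of_nonneg_left (hpt x) (hw x)
    _ = Real.exp (-(l * Real.log (A / B))) *
        (l * ((∑ x, w x * Real.exp (f x)) * A) +
          (1 - l) * ((∑ x, w x * Real.exp (g x)) * B)) := by
        simp only [Finset.sum_mul, Finset.mul_sum]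
        rw [← Finset.sum_add_distrib, Finset.mul_sum]
        exact Finset.sum_congr rfl fun x _ => by ring
    _ ≤ Real.exp (-(l * Real.log (A / B))) * 1 := by
        refine mul_le_mul_of_nonneg_left ?_ (Real.exp_pos _).le
        nlinarith
    _ = _ := mul_one _

lemma sq_interpolate_le (a b : ℝ) {l : ℝ} (h0 : 0 ≤ l) (h1 : l ≤ 1) :
    (l * a + (1 - l) * b) ^ 2 ≤ l * a ^ 2 + (1 - l) * b ^ 2 := by
  nlinarith [mul_nonneg (mul_nonneg h0 (sub_nonneg.mpr h1)) (sq_nonneg (a - b))]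

/-- Talagrand's convex distance inequality for powers of a finite weighted space, the convex
distance being witnessed by the vectors `v x`. -/
theorem talagrand_convex_distance {w : α → ℝ} (hw : ∀ a, 0 ≤ w a) (hs : ∑ a, w a ≤ 1) (m : ℕ) :
    ∀ A : Set (Fin m → α), 0 < wProb (prodW w) A →
      ∃ v : (Fin m → α) → Fin m → ℝ, (∀ x, Dominates A x (v x)) ∧
        (∑ x, prodW w x * Real.exp ((∑ i, v x i ^ 2) / 4)) * wProb (prodW w) A ≤ 1 := by
  induction m with
  | zero =>
    intro A hA
    have hne : A.Nonempty := by
      by_contra h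
      rw [Set.not_nonempty_iff_eq_empty.mp h, wProb_empty] at hA
      exact lt_irrefl _ hA
    obtain ⟨y, hy⟩ := hne
    refine ⟨fun _ _ => 0, fun x c t _ h => by simpa using h y hy, ?_⟩
    have h1 := wProb_le_one (fun x => prodW_nonneg hw x) (sum_prodW_le_one (β := Fin 0) hw hs) A
    simpa [show prodW w = fun _ : Fin 0 → α => (1 : ℝ) from funext fun x => by simp [prodW]]
      using h1
  | succ m ih =>
    intro A hA
    set S : α → Set (Fin m → α) := fun a => {x | (Fin.cons a x : Fin (m + 1) → α) ∈ A}
    set B : Set (Fin m → α) := {x | ∃ b, (Fin.cons b x : Fin (m + 1) → α) ∈ A}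
    have hAS : wProb (prodW w) A = ∑ a, w a * wProb (prodW w) (S a) := wProb_prodW_succ w A
    have hSB : ∀ a, wProb (prodW w) (S a) ≤ wProb (prodW w) B := fun a =>
      wProb_mono (fun x => prodW_nonneg hw x) fun x hx => ⟨a, hx⟩
    have hBnn : 0 ≤ wProb (prodW w) B := wProb_nonneg (fun x => prodW_nonneg hw x) B
    have hAB : wProb (prodW w) A ≤ wProb (prodW w) B := by
      calc wProb (prodW w) A ≤ ∑ a, w a * wProb (prodW w) B := by
            rw [hAS]
            exact Finset.sum_le_sum fun a _ => mul_le_mul_of_nonneg_left (hSB a) (hw a)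
        _ = (∑ a, w a) * wProb (prodW w) B := by rw [Finset.sum_mul]
        _ ≤ 1 * wProb (prodW w) B := mul_le_mul_of_nonneg_right hs hBnn
        _ = _ := one_mul _
    have hBpos := hA.trans_le hAB
    obtain ⟨v, hv, hvB⟩ := ih B hBpos
    have hsec : ∀ a, ∃ u : (Fin m → α) → Fin (m + 1) → ℝ,
        (∀ x, Dominates A (Fin.cons a x) (u x)) ∧
        (∑ x, prodW w x * Real.exp ((∑ i, u x i ^ 2) / 4)) * wProb (prodW w) B ≤
          2 - wProb (prodW w) (S a) / wProb (prodW w) B := by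
      intro a
      rcases (wProb_nonneg (fun x => prodW_nonneg hw x) (S a)).eq_or_lt with hz | hpos
      · refine ⟨fun x => Fin.cons 1 (v x), fun x => (hv x).cons_projection a, ?_⟩
        rw [← hz, zero_div, sub_zero]
        have he : Real.exp (1 / 4) ≤ 2 := by
          have := exp_le_cubic (v := 1 / 4) (by norm_num) (by norm_num)
          norm_num at this ⊢
          linarith
        calc _ = Real.exp (1 / 4) *
              ((∑ x, prodW w x * Real.exp ((∑ i, v x i ^ 2) / 4)) * wProb (prodW w) B) := by
              rw [← mul_assoc, Finset.mul_sum]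
              congr 1
              refine Finset.sum_congr rfl fun x _ => ?_
              simp only [Fin.sum_univ_succ, Fin.cons_zero, Fin.cons_succ, one_pow, add_div,
                Real.exp_add]
              ring
          _ ≤ Real.exp (1 / 4) * 1 := mul_le_mul_of_nonneg_left hvB (Real.exp_pos _).le
          _ ≤ 2 := by linarith
      · obtain ⟨u, hu, huS⟩ := ih (S a) hpos
        obtain ⟨l, h0, h1, hl⟩ := exists_interpolation (div_pos hpos hBpos)
          ((div_le_one hBpos).mpr (hSB a))
        refine ⟨fun x i => l * (Fin.cons 0 (u x) : Fin (m + 1) → ℝ) i +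
          (1 - l) * (Fin.cons 1 (v x) : Fin (m + 1) → ℝ) i,
          fun x => (hu x).cons_section.convex_comb ((hv x).cons_projection a) h0 h1, ?_⟩
        refine le_trans ?_ hl
        have key := sum_exp_interpolate_le (fun x => prodW_nonneg hw x) hpos hBpos h0 h1 huS hvB
        calc _ ≤ (Real.exp ((1 - l) ^ 2 / 4) * ∑ x, prodW w x *
              Real.exp (l * ((∑ i, u x i ^ 2) / 4) + (1 - l) * ((∑ i, v x i ^ 2) / 4))) *
                wProb (prodW w) B := by
              refine mul_le_mul_of_nonneg_right ?_ hBnn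
              rw [Finset.mul_sum]
              refine Finset.sum_le_sum fun x _ => ?_
              rw [mul_left_comm, ← Real.exp_add]
              refine mul_le_mul_of_nonneg_left (Real.exp_le_exp.mpr ?_) (prodW_nonneg hw x)
              have hsq : ∑ i, (l * u x i + (1 - l) * v x i) ^ 2 ≤
                  l * ∑ i, u x i ^ 2 + (1 - l) * ∑ i, v x i ^ 2 := by
                rw [Finset.mul_sum, Finset.mul_sum, ← Finset.sum_add_distrib]
                exact Finset.sum_le_sum fun i _ => sq_interpolate_le _ _ h0 h1
              simp only [Fin.sum_univ_succ, Fin.cons_zero, Fin.cons_succ]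
              nlinarith
          _ ≤ Real.exp ((1 - l) ^ 2 / 4) *
              Real.exp (-(l * Real.log (wProb (prodW w) (S a) / wProb (prodW w) B))) := by
              rw [mul_assoc]
              exact mul_le_mul_of_nonneg_left key (Real.exp_pos _).le
          _ = _ := by rw [← Real.exp_add, add_comm]
    choose u hu huB using hsec
    refine ⟨fun z => u (z 0) (Fin.tail z), fun z => ?_, ?_⟩
    · simpa using hu (z 0) (Fin.tail z)
    · set b := wProb (prodW w) B
      have hsum : (∑ z : Fin (m + 1) → α, prodW w z *
          Real.exp ((∑ i, u (z 0) (Fin.tail z) i ^ 2) / 4)) * b ≤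
          2 - wProb (prodW w) A / b := by
        calc _ = ∑ a, w a *
              ((∑ x, prodW w x * Real.exp ((∑ i, u a x i ^ 2) / 4)) * b) := by
              rw [sum_fin_succ_arrow, Finset.sum_mul]
              refine Finset.sum_congr rfl fun a _ => ?_
              rw [← mul_assoc, Finset.mul_sum]
              congr 1
              refine Finset.sum_congr rfl fun x _ => ?_
              rw [prodW_cons, Fin.cons_zero, Fin.tail_cons, mul_assoc]
          _ ≤ ∑ a, w a * (2 - wProb (prodW w) (S a) / b) :=
              Finset.sum_le_sum fun a _ => mul_le_mul_of_nonneg_left (huB a) (hw a)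
          _ = 2 * (∑ a, w a) - wProb (prodW w) A / b := by
              rw [hAS, Finset.sum_div, Finset.mul_sum, ← Finset.sum_sub_distrib]
              exact Finset.sum_congr rfl fun a _ => by ring
          _ ≤ _ := by linarith
      set E := ∑ z : Fin (m + 1) → α, prodW w z *
          Real.exp ((∑ i, u (z 0) (Fin.tail z) i ^ 2) / 4)
      have hq : 0 ≤ wProb (prodW w) A / b := div_nonneg hA.le hBnn
      calc E * wProb (prodW w) A = (E * b) * (wProb (prodW w) A / b) := by
            field_simp
        _ ≤ (2 - wProb (prodW w) A / b) * (wProb (prodW w) A / b) :=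
            mul_le_mul_of_nonneg_right hsum hq
        _ ≤ 1 := by nlinarith [sq_nonneg (wProb (prodW w) A / b - 1)]

/-- Talagrand's inequality for certifiable random variables on a power of a finite weighted
space. -/
theorem wProb_mul_wProb_le_fin {w : α → ℝ} (hw : ∀ a, 0 ≤ w a) (hs : ∑ a, w a ≤ 1) {m : ℕ}
    (X : (Fin m → α) → ℕ) {b : ℕ} {a c : ℝ} (hc : 0 < c) (hab : a ≤ b)
    (hX : ∀ x, b ≤ X x → ∃ I : Finset (Fin m), (I.card : ℝ) ≤ c ∧
      ∀ y, b ≤ X y + (I.filter fun i => x i ≠ y i).card) :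
    wProb (prodW w) {x | (X x : ℝ) ≤ a} * wProb (prodW w) {x | b ≤ X x} ≤
      Real.exp (-(b - a) ^ 2 / (4 * c)) := by
  rcases (wProb_nonneg (fun x => prodW_nonneg hw x) {x | (X x : ℝ) ≤ a}).eq_or_lt with hz | hpos
  · rw [← hz, zero_mul]
    exact (Real.exp_pos _).le
  obtain ⟨v, hv, hvA⟩ := talagrand_convex_distance hw hs m _ hpos
  have hfar : ∀ x, b ≤ X x → (b - a) ^ 2 / (4 * c) ≤ (∑ i, v x i ^ 2) / 4 := by
    intro x hx
    obtain ⟨I, hI, hIX⟩ := hX x hx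
    have h1 : (b : ℝ) - a ≤ ∑ i ∈ I, v x i := by
      have := hv x (fun i => if i ∈ I then 1 else 0) (b - a) (fun i => by split_ifs <;> simp)
        fun y hy => by
          have h2 : ((b : ℕ) : ℝ) ≤ (X y : ℝ) + ((I.filter fun i => x i ≠ y i).card : ℝ) := by
            exact_mod_cast hIX y
          have h3 : (∑ i, (if i ∈ I then (1 : ℝ) else 0) * if x i = y i then 0 else 1) =
              ((I.filter fun i => x i ≠ y i).card : ℝ) := by
            simp only [ite_mul, one_mul, zero_mul]
            rw [Finset.sum_ite_mem, Finset.univ_inter, Finset.card_filter]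
            push_cast
            exact Finset.sum_congr rfl fun i _ => by split_ifs <;> simp_all
          rw [h3]
          have h4 : (X y : ℝ) ≤ a := hy
          linarith
      simpa using this
    have h2 : (∑ i ∈ I, v x i) ^ 2 ≤ I.card * ∑ i ∈ I, v x i ^ 2 := sq_sum_le_card_mul_sum_sq
    have h3 : ∑ i ∈ I, v x i ^ 2 ≤ ∑ i, v x i ^ 2 :=
      Finset.sum_le_sum_of_subset_of_nonneg (Finset.subset_univ I) fun i _ _ => sq_nonneg _
    have h4 : 0 ≤ ∑ i ∈ I, v x i ^ 2 := Finset.sum_nonneg fun i _ => sq_nonneg _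
    have h5 : ((b : ℝ) - a) ^ 2 ≤ (∑ i ∈ I, v x i) ^ 2 :=
      pow_le_pow_left₀ (by linarith) h1 2
    have h6 : (I.card : ℝ) * ∑ i ∈ I, v x i ^ 2 ≤ c * ∑ i, v x i ^ 2 :=
      mul_le_mul hI h3 h4 hc.le
    rw [div_le_div_iff₀ (by positivity) (by norm_num)]
    nlinarith
  have hE : wProb (prodW w) {x | b ≤ X x} * Real.exp ((b - a) ^ 2 / (4 * c)) ≤
      ∑ x, prodW w x * Real.exp ((∑ i, v x i ^ 2) / 4) := by
    rw [wProb_eq_sum_ite, Finset.sum_mul]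
    refine Finset.sum_le_sum fun x _ => ?_
    have hp := prodW_nonneg hw x
    by_cases hx : b ≤ X x
    · simp only [Set.mem_ofPred_eq, hx, if_true]
      exact mul_le_mul_of_nonneg_left (Real.exp_le_exp.mpr (hfar x hx)) hp
    · simp only [Set.mem_ofPred_eq, hx, if_false, zero_mul]
      exact mul_nonneg hp (Real.exp_pos _).le
  rw [neg_div, Real.exp_neg, ← one_div, le_div_iff₀ (Real.exp_pos _)]
  nlinarith [mul_le_mul_of_nonneg_right hE hpos.le]

/-- Talagrand's inequality for certifiable random variables on a finite weighted space that is
encoded as a power. -/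
theorem wProb_mul_wProb_le {Ω ι : Type*} [Fintype Ω] [Fintype ι] {w : α → ℝ}
    (hw : ∀ a, 0 ≤ w a) (hs : ∑ a, w a ≤ 1) (φ : Ω ≃ (ι → α)) {W : Ω → ℝ}
    (hW : ∀ ω, W ω = prodW w (φ ω)) (X : Ω → ℕ) {b : ℕ} {a c : ℝ} (hc : 0 < c) (hab : a ≤ b)
    (hX : ∀ x, b ≤ X x → ∃ I : Finset ι, (I.card : ℝ) ≤ c ∧
      ∀ y, b ≤ X y + (I.filter fun i => φ x i ≠ φ y i).card) :
    wProb W {x | (X x : ℝ) ≤ a} * wProb W {x | b ≤ X x} ≤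
      Real.exp (-(b - a) ^ 2 / (4 * c)) := by
  let e := Fintype.equivFin ι
  let ψ : Ω ≃ (Fin (Fintype.card ι) → α) := φ.trans (e.arrowCongr (Equiv.refl α))
  have hψ : ∀ ω i, φ ω i = ψ ω (e i) := fun ω i => by simp [ψ]
  have hWψ : ∀ ω, W ω = prodW w (ψ ω) := fun ω => by
    rw [hW, prodW, prodW]
    exact Fintype.prod_equiv e _ _ fun i => by rw [hψ]
  rw [wProb_equiv ψ W _ hWψ, wProb_equiv ψ W _ hWψ]
  refine wProb_mul_wProb_le_fin hw hs (fun z => X (ψ.symm z)) hc hab fun z hz => ?_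
  obtain ⟨I, hI, hIX⟩ := hX _ hz
  refine ⟨I.map e.toEmbedding, by simpa using hI, fun y => (hIX (ψ.symm y)).trans ?_⟩
  rw [Finset.filter_map, Finset.card_map]
  simp [hψ]

end Talagrand

/-- Two-point inequalities of Talagrand type imply concentration around any median. -/
theorem tails_of_wProb_mul_wProb_le {Ω : Type*} [Fintype Ω] {W : Ω → ℝ} (hW : ∀ ω, 0 ≤ W ω)
    (hs : ∑ ω, W ω ≤ 1) (X : Ω → ℕ) {r : ℝ} (hr : 0 < r)
    (hX : ∀ (b : ℕ) (a : ℝ), 0 < b → a ≤ b →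
      wProb W {x | (X x : ℝ) ≤ a} * wProb W {x | b ≤ X x} ≤
        Real.exp (-(b - a) ^ 2 / (4 * (r * b))))
    {Med : ℝ} (hMed : IsMedianW W (fun ω => (X ω : ℝ)) Med) {s : ℝ} (h0 : 0 ≤ s) :
    wProb W {ω | (X ω : ℝ) ≤ (1 - s) * Med} ≤ 2 * Real.exp (-(s ^ 2 * Med) / (4 * r)) ∧
      wProb W {ω | (1 + s) * Med ≤ (X ω : ℝ)} ≤
        2 * Real.exp (-(s ^ 2 / (1 + s) * Med) / (4 * r)) := by
  obtain ⟨hlow, hupp⟩ := hMed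
  have hneg : ∀ a : ℝ, a < 0 → wProb W {ω | (X ω : ℝ) ≤ a} = 0 := fun a ha => by
    have : {ω | (X ω : ℝ) ≤ a} = ∅ := by
      ext ω
      simp only [Set.mem_ofPred_eq, Set.mem_empty_iff_false, iff_false, not_le]
      exact ha.trans_le (Nat.cast_nonneg _)
    rw [this, wProb_empty]
  have hM0 : 0 ≤ Med := by
    by_contra h
    rw [hneg _ (not_le.mp h)] at hlow
    norm_num at hlow
  rcases hM0.eq_or_lt with rfl | hM
  · constructor <;>
    · refine (wProb_le_one hW hs _).trans ?_
      norm_num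
  constructor
  · rcases lt_or_ge ((1 - s) * Med) 0 with ha | ha
    · rw [hneg _ ha]
      positivity
    have hs1 : s ≤ 1 := by
      by_contra h
      exact absurd ha (not_le.mpr (mul_neg_of_neg_of_pos (by linarith) hM))
    have hb := Nat.le_ceil Med
    have hbpos : 0 < ⌈Med⌉₊ := Nat.ceil_pos.mpr hM
    have hset : {ω | Med ≤ (X ω : ℝ)} = {ω | ⌈Med⌉₊ ≤ X ω} := by
      ext ω
      simp [Nat.ceil_le]
    rw [hset] at hupp
    generalize ⌈Med⌉₊ = b at *
    have key := hX b ((1 - s) * Med) hbpos (by nlinarith)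
    have hb' : (0 : ℝ) < b := by exact_mod_cast hbpos
    have hexp : Real.exp (-(b - (1 - s) * Med) ^ 2 / (4 * (r * b))) ≤
        Real.exp (-(s ^ 2 * Med) / (4 * r)) := by
      refine Real.exp_le_exp.mpr ?_
      rw [div_le_div_iff₀ (by positivity) (by positivity)]
      have : s ^ 2 * Med * b ≤ (b - (1 - s) * Med) ^ 2 := by
        obtain ⟨δ, hδ⟩ : ∃ δ, (b : ℝ) = Med + δ := ⟨b - Med, by ring⟩
        have hδ0 : 0 ≤ δ := by linarith
        rw [hδ]
        nlinarith [mul_nonneg (mul_nonneg (mul_nonneg hM.le hδ0) h0) (sub_nonneg.mpr hs1),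
          mul_nonneg (mul_nonneg hM.le hδ0) h0, sq_nonneg δ]
      nlinarith
    nlinarith [wProb_nonneg hW {ω | (X ω : ℝ) ≤ (1 - s) * Med}]
  · have h1s : 0 < 1 + s := by linarith
    have hb := Nat.le_ceil ((1 + s) * Med)
    have hbpos : 0 < ⌈(1 + s) * Med⌉₊ := Nat.ceil_pos.mpr (mul_pos h1s hM)
    have hset : {ω | (1 + s) * Med ≤ (X ω : ℝ)} = {ω | ⌈(1 + s) * Med⌉₊ ≤ X ω} := by
      ext ω
      simp [Nat.ceil_le]
    rw [hset]
    generalize ⌈(1 + s) * Med⌉₊ = b at *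
    have key := hX b Med hbpos (by nlinarith)
    have hb' : (0 : ℝ) < b := by exact_mod_cast hbpos
    have hexp : Real.exp (-(b - Med) ^ 2 / (4 * (r * b))) ≤
        Real.exp (-(s ^ 2 / (1 + s) * Med) / (4 * r)) := by
      refine Real.exp_le_exp.mpr ?_
      have : s ^ 2 / (1 + s) * Med * b ≤ (b - Med) ^ 2 := by
        rw [div_mul_eq_mul_div, div_mul_eq_mul_div, div_le_iff₀ h1s]
        obtain ⟨δ, hδ⟩ : ∃ δ, (b : ℝ) = (1 + s) * Med + δ := ⟨b - (1 + s) * Med, by ring⟩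
        have hδ0 : 0 ≤ δ := by linarith
        have hsM := mul_nonneg (mul_nonneg hM.le hδ0) h0
        rw [hδ]
        nlinarith [mul_nonneg hsM h0, mul_nonneg (sq_nonneg δ) h0, sq_nonneg δ]
      rw [div_le_div_iff₀ (by positivity) (by positivity)]
      nlinarith
    nlinarith [wProb_nonneg hW {ω | b ≤ X ω}]

section Matchings

variable {d : ℕ} {n : Fin d → ℕ}

lemma NonCrossing.subset {M N : Finset (Edge n)} (hM : NonCrossing M) (h : N ⊆ M) :
    NonCrossing N :=
  fun e he f hf => hM e (h he) f (h hf)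

lemma NonCrossing.card_le_L {M : Finset (Edge n)} (hM : NonCrossing M) {G : HG n} (h : M ⊆ G) :
    M.card ≤ L G := by
  unfold L
  refine Finset.le_sup (f := Finset.card) ?_
  simp [h, hM]

lemma exists_nonCrossing_card_eq {G : HG n} {b : ℕ} (hb : b ≤ L G) :
    ∃ M : Finset (Edge n), M ⊆ G ∧ NonCrossing M ∧ M.card = b := by
  have hne : (G.powerset.filter NonCrossing).Nonempty :=
    ⟨∅, by simp [NonCrossing]⟩
  obtain ⟨M, hM, hMc⟩ := Finset.exists_mem_eq_sup _ hne Finset.card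
  simp only [Finset.mem_filter, Finset.mem_powerset] at hM
  have hb' : b ≤ M.card := by
    rw [← hMc]
    exact hb
  obtain ⟨N, hN, hNc⟩ := Finset.exists_subset_card_eq hb'
  exact ⟨N, hN.trans hM.1, hM.2.subset hN, hNc⟩

lemma NonCrossing.eq_of_coord_eq {M : Finset (Edge n)} (hM : NonCrossing M) {e f : Edge n}
    (he : e ∈ M) (hf : f ∈ M) {i : Fin d} (h : e i = f i) : e = f := by
  by_contra hne
  rcases hM e he f hf hne with h' | h'
  · exact (h' i).ne h
  · exact (h' i).ne h.symm

lemma L_certificate_edges (H : HG n) {b : ℕ} (hb : b ≤ L H) :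
    ∃ I : Finset (Edge n), I.card = b ∧
      ∀ G : HG n, b ≤ L G + (I.filter fun e => decide (e ∈ H) ≠ decide (e ∈ G)).card := by
  obtain ⟨M, hMH, hM, rfl⟩ := exists_nonCrossing_card_eq hb
  refine ⟨M, rfl, fun G => ?_⟩
  have h1 : (M.filter fun e => e ∈ G).card ≤ L G :=
    (hM.subset (Finset.filter_subset _ _)).card_le_L fun e he => (Finset.mem_filter.mp he).2
  have h2 : (M.filter fun e => e ∉ G).card ≤
      (M.filter fun e => decide (e ∈ H) ≠ decide (e ∈ G)).card := by
    refine Finset.card_le_card fun e he => ?_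
    rw [Finset.mem_filter] at he ⊢
    exact ⟨he.1, by simp [he.2, hMH he.1]⟩
  have h3 := Finset.card_filter_add_card_filter_not (s := M) fun e => e ∈ G
  omega

lemma L_wordGraph_certificate {k : ℕ} (ω : WordOmega n k) {b : ℕ} (hb : b ≤ L (wordGraph ω)) :
    ∃ I : Finset (Σ i : Fin d, Fin (n i)), I.card ≤ d * b ∧
      ∀ ω' : WordOmega n k,
        b ≤ L (wordGraph ω') + (I.filter fun x => ω x ≠ ω' x).card := by
  obtain ⟨M, hMω, hM, rfl⟩ := exists_nonCrossing_card_eq hb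
  let V : Fin d × Edge n → Σ i : Fin d, Fin (n i) := fun q => ⟨q.1, q.2 q.1⟩
  refine ⟨(Finset.univ ×ˢ M).image V, ?_, fun ω' => ?_⟩
  · refine Finset.card_image_le.trans ?_
    simp [Finset.card_product]
  have h1 : (M.filter fun e => ∀ i, ω ⟨i, e i⟩ = ω' ⟨i, e i⟩).card ≤ L (wordGraph ω') := by
    refine (hM.subset (Finset.filter_subset _ _)).card_le_L fun e he => ?_
    rw [Finset.mem_filter] at he
    have := hMω he.1
    simp only [wordGraph, Finset.mem_filter, Finset.mem_univ, true_and] at this ⊢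
    intro i j
    rw [← he.2 i, ← he.2 j]
    exact this i j
  have h2 : (M.filter fun e => ¬ ∀ i, ω ⟨i, e i⟩ = ω' ⟨i, e i⟩).card ≤
      (((Finset.univ ×ˢ M).image V).filter fun x => ω x ≠ ω' x).card := by
    refine Finset.card_le_card_of_forall_subsingleton (fun e x => x.2 = e x.1) ?_ ?_
    · intro e he
      rw [Finset.mem_filter] at he
      obtain ⟨i, hi⟩ := not_forall.mp he.2
      refine ⟨⟨i, e i⟩, ?_, rfl⟩
      rw [Finset.mem_filter, Finset.mem_image]
      exact ⟨⟨(i, e), by simp [he.1], rfl⟩, hi⟩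
    · intro x _ e he f hf
      simp only [Finset.mem_filter, Set.mem_ofPred_eq] at he hf
      exact hM.eq_of_coord_eq he.1.1 hf.1.1 (he.2.symm.trans hf.2)
  have h3 := Finset.card_filter_add_card_filter_not (s := M)
    fun e => ∀ i, ω ⟨i, e i⟩ = ω' ⟨i, e i⟩
  omega

end Matchings

section Models

variable {α : Type*} [Fintype α]

/-- The outcomes of the binomial model as Boolean functions. -/
noncomputable def finsetBoolEquiv (α : Type*) [Fintype α] : Finset α ≃ (α → Bool) where
  toFun H a := decide (a ∈ H)
  invFun f := Finset.univ.filter fun a => f a = true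
  left_inv H := by ext a; simp
  right_inv f := by ext a; simp

/-- The law of a single element in the binomial model. -/
def bernoulliW (p : ℝ) : Bool → ℝ := fun t => if t then p else 1 - p

lemma bernoulliW_nonneg {p : ℝ} (hp0 : 0 ≤ p) (hp1 : p ≤ 1) (t : Bool) : 0 ≤ bernoulliW p t := by
  cases t <;> simp [bernoulliW, hp0, hp1]

lemma sum_bernoulliW (p : ℝ) : ∑ t, bernoulliW p t = 1 := by
  simp [bernoulliW]

lemma binomW_eq_prodW (p : ℝ) (H : Finset α) :
    binomW p H = prodW (bernoulliW p) (finsetBoolEquiv α H) := by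
  simp [binomW, prodW, bernoulliW, finsetBoolEquiv]

lemma binomW_nonneg {p : ℝ} (hp0 : 0 ≤ p) (hp1 : p ≤ 1) (H : Finset α) : 0 ≤ binomW p H := by
  rw [binomW_eq_prodW]
  exact prodW_nonneg (bernoulliW_nonneg hp0 hp1) _

lemma sum_binomW_le_one {p : ℝ} (hp0 : 0 ≤ p) (hp1 : p ≤ 1) :
    ∑ H : Finset α, binomW p H ≤ 1 := by
  rw [Fintype.sum_equiv (finsetBoolEquiv α) _ _ fun H => binomW_eq_prodW p H]
  exact sum_prodW_le_one (bernoulliW_nonneg hp0 hp1) (sum_bernoulliW p).le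

lemma unifW_nonneg (a : α) : 0 ≤ unifW α a := by
  simp [unifW]

lemma sum_unifW_le_one : ∑ a, unifW α a ≤ 1 := by
  simp only [unifW, Finset.sum_const, nsmul_eq_mul, Finset.card_univ]
  exact mul_inv_le_one

lemma unifW_eq_prodW {ι : Type*} [Fintype ι] [Fintype (ι → α)] (x : ι → α) :
    unifW (ι → α) x = prodW (unifW α) x := by
  simp [unifW, prodW, ← Nat.card_eq_fintype_card, Nat.card_fun]

end Models

/-- The `d`-dimensional binomial random hyper-graph model has concentration constant `1/4`,
and the random `d`-word model has concentration constant `1/(4d)`. -/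
theorem models_concentration_constants (d : ℕ) (n : Fin d → ℕ)
    (p : ℝ) (hp0 : 0 ≤ p) (hp1 : p ≤ 1) (k : ℕ) :
    (∀ Med : ℝ, IsMedianW (binomW p : HG n → ℝ) (fun H => (L H : ℝ)) Med →
      ∀ s : ℝ, 0 ≤ s →
        wProb (binomW p : HG n → ℝ) {H | (L H : ℝ) ≤ (1 - s) * Med} ≤
          2 * Real.exp (-(s ^ 2 * Med) / 4) ∧
        wProb (binomW p : HG n → ℝ) {H | (1 + s) * Med ≤ (L H : ℝ)} ≤
          2 * Real.exp (-(s ^ 2 / (1 + s) * Med) / 4)) ∧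
    (∀ Med : ℝ,
      IsMedianW (unifW (WordOmega n k)) (fun ω => (L (wordGraph ω) : ℝ)) Med →
      ∀ s : ℝ, 0 ≤ s →
        wProb (unifW (WordOmega n k)) {ω | (L (wordGraph ω) : ℝ) ≤ (1 - s) * Med} ≤
          2 * Real.exp (-(s ^ 2 * Med) / (4 * (d : ℝ))) ∧
        wProb (unifW (WordOmega n k)) {ω | (1 + s) * Med ≤ (L (wordGraph ω) : ℝ)} ≤
          2 * Real.exp (-(s ^ 2 / (1 + s) * Med) / (4 * (d : ℝ)))) := by
  refine ⟨fun Med hMed s h0 => ?_, fun Med hMed s h0 => ?_⟩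
  · have h := tails_of_wProb_mul_wProb_le (W := (binomW p : HG n → ℝ)) (binomW_nonneg hp0 hp1)
      (sum_binomW_le_one hp0 hp1) L one_pos (fun b a hb hab =>
        wProb_mul_wProb_le (bernoulliW_nonneg hp0 hp1) (sum_bernoulliW p).le
          (finsetBoolEquiv (Edge n)) (binomW_eq_prodW p) L (by positivity) hab fun H hH => by
            obtain ⟨I, hI, hIG⟩ := L_certificate_edges H hH
            exact ⟨I, by simp [hI], fun G => by convert hIG G <;> simp [finsetBoolEquiv]⟩) hMed h0
    simpa only [mul_one] using h
  · rcases Nat.eq_zero_or_pos d with rfl | hd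
    · have h1 := fun A : Set (WordOmega n k) =>
        wProb_le_one unifW_nonneg (sum_unifW_le_one (α := WordOmega n k)) A
      constructor <;>
      · refine (h1 _).trans ?_
        norm_num
    have hd' : (0 : ℝ) < d := by exact_mod_cast hd
    refine tails_of_wProb_mul_wProb_le (W := unifW (WordOmega n k)) unifW_nonneg sum_unifW_le_one
      (fun ω => L (wordGraph ω)) hd' (fun b a hb hab => ?_) hMed h0
    refine wProb_mul_wProb_le (w := unifW (Fin k)) unifW_nonneg sum_unifW_le_one
      (Equiv.refl (WordOmega n k)) unifW_eq_prodW (fun ω => L (wordGraph ω)) (by positivity) hab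
      fun ω hω => ?_
    obtain ⟨I, hI, hIω⟩ := L_wordGraph_certificate ω hω
    exact ⟨I, by exact_mod_cast hI, fun ω' => by convert hIω ω' <;> rfl⟩
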